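/- In ℂ[x,y], define f2 = 1 - (1/3)xy + (8203/31752)y^2 + (1/3)y - (5444/3969)x + (1475/3969)x^2, g2 = 1 - xy + (21139/31752)y^2 + y - (14857/7938)x + (6919/7938)x^2, and h2 = -1 + xy - (24667/31752)y^2 + y + (1475/3969)x - (36115/47628)x^2. Let g = f2^3 + g2^2 * h2. Then g is irreducible in ℂ[x,y], and there do not exist polynomials p, q ∈ ℂ[x,y] with total degree of p at most 2 and total degree of q at most 3 such that g = p^3 + q^2. -/

import Mathlib

open MvPolynomial

noncomputable section

def x : MvPolynomial (Fin 2) ℂ := X 0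
def y : MvPolynomial (Fin 2) ℂ := X 1
def c (q : ℚ) : MvPolynomial (Fin 2) ℂ := C (q : ℂ)

def f2 : MvPolynomial (Fin 2) ℂ :=
  1 - c (1/3) * x * y + c (8203/31752) * y ^ 2 + c (1/3) * y - c (5444/3969) * x
    + c (1475/3969) * x ^ 2

def g2 : MvPolynomial (Fin 2) ℂ :=
  1 - x * y + c (21139/31752) * y ^ 2 + y - c (14857/7938) * x + c (6919/7938) * x ^ 2

def h2 : MvPolynomial (Fin 2) ℂ :=
  -1 + x * y - c (24667/31752) * y ^ 2 + y + c (1475/3969) * x - c (36115/47628) * x ^ 2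

/-- The sextic of semi-torus type with configuration `[2A_5 + 2A_2]`. -/
def g : MvPolynomial (Fin 2) ℂ := f2 ^ 3 + g2 ^ 2 * h2

/-! ### Linear algebra modulo 13 -/

def dot : List ℕ → List ℕ → ℕ
  | a :: l, b :: m => a * b + dot l m
  | _, _ => 0

lemma dot_eq (N : ℕ) : ∀ l m : List ℕ, l.length ≤ N →
    dot l m = ∑ j : Fin N, l.getD j 0 * m.getD j 0 := by
  induction N with
  | zero =>
    intro l m h
    have : l = [] := List.length_eq_zero_iff.mp (by omega)
    subst this
    simp [dot]
  | succ N ih =>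
    intro l m h
    cases l with
    | nil => simp [dot]
    | cons a l =>
      cases m with
      | nil => simp [dot]
      | cons b m =>
        rw [Fin.sum_univ_succ]
        simp only [dot, Fin.val_zero, Fin.val_succ, List.getD_cons_zero, List.getD_cons_succ]
        rw [ih l m (by simpa using h)]

lemma kernel_zero (N : ℕ) (M : Fin N → Fin N → ℤ) (NL TL : List (List ℕ))
    (hl : ∀ i : Fin N, (NL.getD i []).length ≤ N)
    (hN : ∀ i k : Fin N, dot (NL.getD i []) (TL.getD k []) % 13 = if i = k then 1 else 0)
    (hT : ∀ j k : Fin N, (M j k - ((TL.getD k []).getD j 0 : ℕ)) % 13 = 0)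
    (u : Fin N → ℂ) (hu : ∀ j, ∑ k, (M j k : ℂ) * u k = 0) : u = 0 := by
  have : Fact (Nat.Prime 13) := ⟨by norm_num⟩
  let Mz : Matrix (Fin N) (Fin N) ℤ := Matrix.of M
  let Nz : Matrix (Fin N) (Fin N) (ZMod 13) := Matrix.of fun i j => ((NL.getD i []).getD j 0 : ℕ)
  have h1 : Nz * Mz.map (Int.castRingHom (ZMod 13)) = 1 := by
    ext i k
    have hM : ∀ j, ((M j k : ℤ) : ZMod 13) = (((TL.getD k []).getD j 0 : ℕ) : ZMod 13) := by
      intro j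
      have h := Int.dvd_of_emod_eq_zero (hT j k)
      have h' := (ZMod.intCast_zmod_eq_zero_iff_dvd _ 13).mpr (by exact_mod_cast h)
      push_cast at h'
      exact sub_eq_zero.mp h'
    have h2 := hN i k
    rw [dot_eq N _ _ (hl i)] at h2
    have h3 := congrArg (Nat.cast : ℕ → ZMod 13) h2
    rw [ZMod.natCast_mod] at h3
    push_cast at h3
    rw [Matrix.mul_apply, Matrix.one_apply]
    simp only [Mz, Nz, Matrix.map_apply, Matrix.of_apply, eq_intCast, hM]
    exact h3
  have hdet : Mz.det ≠ 0 := by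
    intro h0
    have h2 := congrArg Matrix.det h1
    have h3 : (Mz.map (Int.castRingHom (ZMod 13))).det = 0 := by
      have := (Int.castRingHom (ZMod 13)).map_det Mz
      rw [RingHom.mapMatrix_apply] at this
      rw [← this, h0, map_zero]
    rw [Matrix.det_mul, h3, Matrix.det_one, mul_zero] at h2
    exact zero_ne_one h2
  have hdet' : (Mz.map (Int.castRingHom ℂ)).det ≠ 0 := by
    have := (Int.castRingHom ℂ).map_det Mz
    rw [RingHom.mapMatrix_apply] at this
    rw [← this]
    simpa using hdet
  apply Matrix.eq_zero_of_mulVec_eq_zero hdet'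
  ext j
  simpa [Matrix.mulVec, dotProduct, Mz] using hu j

/-! ### Expansion of polynomials -/

def toF (k : ℕ × ℕ) : Fin 2 →₀ ℕ := Finsupp.single 0 k.1 + Finsupp.single 1 k.2

lemma toF_zero (k : ℕ × ℕ) : toF k 0 = k.1 := by simp [toF]
lemma toF_one (k : ℕ × ℕ) : toF k 1 = k.2 := by simp [toF]

lemma toF_inj : Function.Injective toF := by
  intro a b h
  ext
  · rw [← toF_zero, h, toF_zero]
  · rw [← toF_one, h, toF_one]

lemma toF_surj (m : Fin 2 →₀ ℕ) : toF (m 0, m 1) = m := by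
  ext i
  fin_cases i
  · exact toF_zero _
  · exact toF_one _

lemma deg_le {A : MvPolynomial (Fin 2) ℂ} {d : ℕ} (hA : A.totalDegree ≤ d) {m : Fin 2 →₀ ℕ}
    (hm : m ∈ A.support) : m 0 + m 1 ≤ d := by
  have := (le_totalDegree hm).trans hA
  rw [Finsupp.sum_fintype _ _ (fun _ => rfl)] at this
  simpa using this

lemma expand {A : MvPolynomial (Fin 2) ℂ} {d n : ℕ} (hA : A.totalDegree ≤ d)
    (mon : Fin n → ℕ × ℕ) (hinj : Function.Injective mon)
    (hs : ∀ k < d + 1, ∀ l < d + 1, k + l ≤ d → ∃ i, mon i = (k, l)) :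
    A = ∑ i, monomial (toF (mon i)) (coeff (toF (mon i)) A) := by
  classical
  conv_lhs => rw [A.as_sum]
  have h1 : A.support ⊆ Finset.univ.image (fun i => toF (mon i)) := by
    intro m hm
    have h := deg_le hA hm
    obtain ⟨i, hi⟩ := hs (m 0) (by omega) (m 1) (by omega) h
    simp only [Finset.mem_image, Finset.mem_univ, true_and]
    exact ⟨i, by rw [hi, toF_surj]⟩
  rw [Finset.sum_subset h1, Finset.sum_image]
  · intro i _ j _ h
    exact hinj (toF_inj h)
  · intro m _ hm
    rw [notMem_support_iff.mp hm, map_zero]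

def ev (s t : ℂ) : MvPolynomial (Fin 2) ℂ →+* ℂ := eval ![s, t]

lemma ev_monomial (s t : ℂ) (k : Fin 2 →₀ ℕ) (a : ℂ) :
    ev s t (monomial k a) = a * (s ^ k 0 * t ^ k 1) := by
  simp [ev, eval_monomial, Finsupp.prod_fintype]

lemma ev_pd0 (s t : ℂ) (k : ℕ × ℕ) (a : ℂ) :
    ev s t (pderiv 0 (monomial (toF k) a)) = a * (k.1 * (s ^ (k.1 - 1) * t ^ k.2)) := by
  rw [pderiv_monomial, ev_monomial]
  simp [toF]
  ring

lemma ev_pd1 (s t : ℂ) (k : ℕ × ℕ) (a : ℂ) :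
    ev s t (pderiv 1 (monomial (toF k) a)) = a * (k.2 * (s ^ k.1 * t ^ (k.2 - 1))) := by
  rw [pderiv_monomial, ev_monomial]
  simp [toF]
  ring

/-! ### Integer versions of the data, scaled by 95256 -/

section IntData
variable {R : Type} [CommRing R]
def fI (s t : R) : R := 95256 - 31752*s*t + 24609*t^2 + 31752*t - 130656*s + 35400*s^2
def gI (s t : R) : R := 95256 - 95256*s*t + 63417*t^2 + 95256*t - 178284*s + 83028*s^2
def hI (s t : R) : R := -95256 + 95256*s*t - 74001*t^2 + 95256*t + 35400*s - 72230*s^2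
def fx (s t : R) : R := - 31752*t - 130656 + 70800*s
def gx (s t : R) : R := - 95256*t - 178284 + 166056*s
def hx (s t : R) : R := 95256*t + 35400 - 144460*s
def fy (s t : R) : R := - 31752*s + 49218*t + 31752
def gy (s t : R) : R := - 95256*s + 126834*t + 95256
def hy (s t : R) : R := 95256*s - 148002*t + 95256
def E0 (s t : R) : R := fI s t ^ 3 + gI s t ^ 2 * hI s t
def Ex (s t : R) : R := 3 * fI s t ^ 2 * fx s t + 2 * gI s t * gx s t * hI s t + gI s t ^ 2 * hx s t
def Ey (s t : R) : R := 3 * fI s t ^ 2 * fy s t + 2 * gI s t * gy s t * hI s t + gI s t ^ 2 * hy s t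
end IntData

lemma ev_C (s t a : ℂ) : ev s t (C a) = a := by simp [ev]
lemma ev_X0 (s t : ℂ) : ev s t (X 0) = s := by simp [ev]
lemma ev_X1 (s t : ℂ) : ev s t (X 1) = t := by simp [ev]

lemma ev_f2 (s t : ℂ) : 95256 * ev s t f2 = fI s t := by
  simp only [f2, x, y, c, map_add, map_sub, map_mul, map_pow, map_one, ev_C, ev_X0, ev_X1, fI]
  push_cast; ring
lemma ev_g2 (s t : ℂ) : 95256 * ev s t g2 = gI s t := by
  simp only [g2, x, y, c, map_add, map_sub, map_mul, map_pow, map_one, ev_C, ev_X0, ev_X1, gI]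
  push_cast; ring
lemma ev_h2 (s t : ℂ) : 95256 * ev s t h2 = hI s t := by
  simp only [h2, x, y, c, map_add, map_sub, map_mul, map_pow, map_one, map_neg, ev_C, ev_X0, ev_X1, hI]
  push_cast; ring

lemma pd0X0 : pderiv 0 (X 0 : MvPolynomial (Fin 2) ℂ) = 1 := pderiv_X_self 0
lemma pd1X1 : pderiv 1 (X 1 : MvPolynomial (Fin 2) ℂ) = 1 := pderiv_X_self 1
lemma pd0X1 : pderiv 0 (X 1 : MvPolynomial (Fin 2) ℂ) = 0 := pderiv_X_of_ne (by decide)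
lemma pd1X0 : pderiv 1 (X 0 : MvPolynomial (Fin 2) ℂ) = 0 := pderiv_X_of_ne (by decide)

lemma ev_f2x (s t : ℂ) : 95256 * ev s t (pderiv 0 f2) = fx s t := by
  simp only [f2, x, y, c, map_add, map_sub, pderiv_mul, pderiv_pow, pderiv_C, pderiv_one, pd0X0, pd0X1, map_mul, map_pow, map_one, map_zero, ev_C, ev_X0, ev_X1, fx, map_natCast]
  push_cast; ring
lemma ev_g2x (s t : ℂ) : 95256 * ev s t (pderiv 0 g2) = gx s t := by
  simp only [g2, x, y, c, map_add, map_sub, pderiv_mul, pderiv_pow, pderiv_C, pderiv_one, pd0X0, pd0X1, map_mul, map_pow, map_one, map_zero, ev_C, ev_X0, ev_X1, gx, map_natCast]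
  push_cast; ring
lemma ev_h2x (s t : ℂ) : 95256 * ev s t (pderiv 0 h2) = hx s t := by
  simp only [h2, x, y, c, map_add, map_sub, map_neg, pderiv_mul, pderiv_pow, pderiv_C, pderiv_one, pd0X0, pd0X1, map_mul, map_pow, map_one, map_zero, ev_C, ev_X0, ev_X1, hx, map_natCast]
  push_cast; ring
lemma ev_f2y (s t : ℂ) : 95256 * ev s t (pderiv 1 f2) = fy s t := by
  simp only [f2, x, y, c, map_add, map_sub, pderiv_mul, pderiv_pow, pderiv_C, pderiv_one, pd1X0, pd1X1, map_mul, map_pow, map_one, map_zero, ev_C, ev_X0, ev_X1, fy, map_natCast]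
  push_cast; ring
lemma ev_g2y (s t : ℂ) : 95256 * ev s t (pderiv 1 g2) = gy s t := by
  simp only [g2, x, y, c, map_add, map_sub, pderiv_mul, pderiv_pow, pderiv_C, pderiv_one, pd1X0, pd1X1, map_mul, map_pow, map_one, map_zero, ev_C, ev_X0, ev_X1, gy, map_natCast]
  push_cast; ring
lemma ev_h2y (s t : ℂ) : 95256 * ev s t (pderiv 1 h2) = hy s t := by
  simp only [h2, x, y, c, map_add, map_sub, map_neg, pderiv_mul, pderiv_pow, pderiv_C, pderiv_one, pd1X0, pd1X1, map_mul, map_pow, map_one, map_zero, ev_C, ev_X0, ev_X1, hy, map_natCast]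
  push_cast; ring

lemma ev_g (s t : ℂ) : 95256 ^ 3 * ev s t g = E0 s t := by
  simp only [g, E0, map_add, map_mul, map_pow, ← ev_f2, ← ev_g2, ← ev_h2]
  ring
lemma ev_gx (s t : ℂ) : 95256 ^ 3 * ev s t (pderiv 0 g) = Ex s t := by
  simp only [g, Ex, map_add, pderiv_mul, pderiv_pow, map_mul, map_pow, map_natCast, ← ev_f2, ← ev_g2, ← ev_h2, ← ev_f2x, ← ev_g2x, ← ev_h2x]
  push_cast; ring
lemma ev_gy (s t : ℂ) : 95256 ^ 3 * ev s t (pderiv 1 g) = Ey s t := by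
  simp only [g, Ey, map_add, pderiv_mul, pderiv_pow, map_mul, map_pow, map_natCast, ← ev_f2, ← ev_g2, ← ev_h2, ← ev_f2y, ← ev_g2y, ← ev_h2y]
  push_cast; ring

lemma E0_cast (s t : ℤ) : ((E0 s t : ℤ) : ℂ) = E0 (s : ℂ) (t : ℂ) := by
  simp only [E0, fI, gI, hI]; push_cast; ring
lemma Ex_cast (s t : ℤ) : ((Ex s t : ℤ) : ℂ) = Ex (s : ℂ) (t : ℂ) := by
  simp only [Ex, fI, gI, hI, fx, gx, hx]; push_cast; ring
lemma Ey_cast (s t : ℤ) : ((Ey s t : ℤ) : ℂ) = Ey (s : ℂ) (t : ℂ) := by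
  simp only [Ey, fI, gI, hI, fy, gy, hy]; push_cast; ring

/-- Matrix entries. -/
def entA (al be : ℤ) (s t : ℤ) (k : ℕ × ℕ) : ℤ :=
  be * E0 s t * (k.2 * (s ^ k.1 * t ^ (k.2 - 1))) - al * Ey s t * (s ^ k.1 * t ^ k.2)
def entB (al be : ℤ) (s t : ℤ) (k : ℕ × ℕ) : ℤ :=
  al * Ex s t * (s ^ k.1 * t ^ k.2) - be * E0 s t * (k.1 * (s ^ (k.1 - 1) * t ^ k.2))

lemma row_eq {A B : MvPolynomial (Fin 2) ℂ} {d n : ℕ} (hA : A.totalDegree ≤ d)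
    (hB : B.totalDegree ≤ d)
    (mon : Fin n → ℕ × ℕ) (hinj : Function.Injective mon)
    (hs : ∀ k < d + 1, ∀ l < d + 1, k + l ≤ d → ∃ i, mon i = (k, l))
    (al be : ℤ)
    (h : C (al : ℂ) * (pderiv 0 g * B - pderiv 1 g * A)
      = C (be : ℂ) * (g * (pderiv 0 B - pderiv 1 A))) (s t : ℤ) :
    ∑ i, (entA al be s t (mon i) : ℂ) * coeff (toF (mon i)) A
      + ∑ i, (entB al be s t (mon i) : ℂ) * coeff (toF (mon i)) B = 0 := by
  have eA := expand hA mon hinj hs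
  have eB := expand hB mon hinj hs
  have h1 := congrArg (ev s t) h
  simp only [map_mul, map_sub, ev_C] at h1
  have a0 : ev s t A = ∑ i, coeff (toF (mon i)) A * ((s:ℂ) ^ (mon i).1 * (t:ℂ) ^ (mon i).2) := by
    conv_lhs => rw [eA]
    simp only [map_sum, ev_monomial, toF_zero, toF_one]
  have b0 : ev s t B = ∑ i, coeff (toF (mon i)) B * ((s:ℂ) ^ (mon i).1 * (t:ℂ) ^ (mon i).2) := by
    conv_lhs => rw [eB]
    simp only [map_sum, ev_monomial, toF_zero, toF_one]
  have a1 : ev s t (pderiv 1 A) = ∑ i, coeff (toF (mon i)) A *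
      ((mon i).2 * ((s:ℂ) ^ (mon i).1 * (t:ℂ) ^ ((mon i).2 - 1))) := by
    conv_lhs => rw [eA]
    simp only [map_sum, ev_pd1]
  have b1 : ev s t (pderiv 0 B) = ∑ i, coeff (toF (mon i)) B *
      ((mon i).1 * ((s:ℂ) ^ ((mon i).1 - 1) * (t:ℂ) ^ (mon i).2)) := by
    conv_lhs => rw [eB]
    simp only [map_sum, ev_pd0]
  have hA' : ∑ i, (entA al be s t (mon i) : ℂ) * coeff (toF (mon i)) A
      = be * E0 (s:ℂ) t * ev s t (pderiv 1 A) - al * Ey (s:ℂ) t * ev s t A := by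
    rw [a0, a1, Finset.mul_sum, Finset.mul_sum, ← Finset.sum_sub_distrib]
    refine Finset.sum_congr rfl fun i _ => ?_
    simp only [entA]
    push_cast
    rw [E0_cast, Ey_cast]
    ring
  have hB' : ∑ i, (entB al be s t (mon i) : ℂ) * coeff (toF (mon i)) B
      = al * Ex (s:ℂ) t * ev s t B - be * E0 (s:ℂ) t * ev s t (pderiv 0 B) := by
    rw [b0, b1, Finset.mul_sum, Finset.mul_sum, ← Finset.sum_sub_distrib]
    refine Finset.sum_congr rfl fun i _ => ?_
    simp only [entB]
    push_cast
    rw [E0_cast, Ex_cast]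
    ring
  rw [hA', hB', ← ev_g, ← ev_gx, ← ev_gy]
  linear_combination 95256 ^ 3 * h1

def mons5 : List (ℕ × ℕ) := [(0, 0), (1, 0), (0, 1), (2, 0), (1, 1), (0, 2), (3, 0), (2, 1), (1, 2), (0, 3), (4, 0), (3, 1), (2, 2), (1, 3), (0, 4), (5, 0), (4, 1), (3, 2), (2, 3), (1, 4), (0, 5)]

def pts5 : List (ℕ × ℕ) := [(0, 1), (0, 1), (0, 2), (1, 1), (2, 0), (0, 3), (1, 2), (2, 1), (3, 0), (0, 4), (1, 3), (2, 2), (3, 1), (4, 0), (0, 5), (1, 4), (2, 3), (3, 2), (4, 1), (5, 0), (0, 6), (1, 5), (2, 4), (3, 3), (4, 2), (5, 1), (6, 0), (0, 7), (1, 6), (2, 5), (3, 4), (4, 3), (5, 2), (6, 1), (7, 0), (0, 8), (1, 7), (2, 6), (3, 5), (4, 4), (5, 3), (6, 2)]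

def NL5 : List (List ℕ) := [
  [0,3,5,4,7,6,7,7,8,4,3,0,0,8,3,9,0,5,7,7,7,6,5,5,12,5,9,7,0,0,2,1,7,0,5,10,7,9,7,3,9,2],
  [2,8,5,5,7,3,11,11,8,0,0,4,6,12,5,1,4,2,4,2,7,5,10,10,8,0,0,12,10,0,11,6,3,12,3,4,3,2,6,2,7,7],
  [0,7,8,4,3,5,6,10,0,5,8,1,1,10,9,0,11,4,2,3,6,9,6,4,5,6,6,8,9,11,2,1,2,8,5,12,3,3,6,10,2,3],
  [0,1,2,8,3,9,3,3,3,0,1,11,7,5,9,9,3,6,4,5,10,2,6,11,7,0,8,0,5,6,10,12,1,11,4,8,8,1,8,2,11,4],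
  [4,12,5,7,4,12,12,5,1,1,9,9,3,5,2,8,0,9,10,3,12,10,0,4,2,5,3,12,0,4,8,1,4,2,0,8,0,1,8,8,0,2],
  [11,4,7,4,4,9,8,1,10,10,0,4,8,8,5,6,5,4,0,10,10,7,11,6,1,4,1,2,12,12,1,8,2,10,9,3,2,3,9,6,3,6],
  [4,10,3,1,0,7,12,10,3,3,7,9,5,9,8,4,7,2,2,12,2,12,9,12,7,6,0,4,12,11,1,7,1,6,10,4,12,4,12,11,6,11],
  [9,5,5,6,3,2,1,9,7,6,12,3,2,5,1,8,8,11,7,1,4,8,7,8,11,11,10,0,8,8,10,10,10,4,3,9,0,11,4,2,10,4],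
  [4,1,2,0,5,8,1,5,8,10,11,2,12,7,1,3,4,10,5,7,3,9,6,6,2,6,9,5,9,4,11,7,5,12,3,3,0,3,3,2,11,12],
  [10,0,12,2,3,0,6,0,6,5,12,11,3,3,1,12,9,2,10,5,4,1,12,2,2,4,5,6,12,12,0,10,6,3,3,6,3,10,9,2,3,8],
  [9,5,7,12,9,5,1,6,2,11,9,10,3,12,1,5,3,4,12,12,11,9,9,11,0,12,3,12,10,7,9,3,7,12,5,0,10,10,12,5,9,4],
  [4,6,4,10,9,4,0,6,6,5,9,2,12,8,0,11,2,5,0,11,10,4,8,10,9,1,12,4,3,12,4,5,10,7,7,12,10,11,2,3,9,12],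
  [12,10,4,11,4,1,12,7,7,9,0,9,3,10,10,12,4,9,11,5,7,2,9,12,4,1,11,12,1,2,6,7,3,10,9,3,10,9,10,4,2,1],
  [10,3,6,1,5,12,8,4,4,12,8,12,3,0,2,10,11,6,1,11,0,6,0,3,5,7,2,1,5,0,11,1,8,10,9,11,10,3,9,12,1,1],
  [6,9,3,12,5,5,11,1,10,9,4,5,6,9,10,0,3,12,10,2,10,10,4,9,6,0,4,8,0,7,7,7,6,3,0,3,9,5,1,2,0,2],
  [11,11,8,0,1,3,3,9,3,8,0,11,4,3,6,12,10,5,1,12,12,8,4,2,9,4,8,4,0,3,2,11,10,11,8,10,0,3,1,11,5,1],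
  [9,6,5,1,5,11,9,7,12,7,7,10,9,3,11,1,12,9,7,1,0,0,8,1,7,10,8,9,1,2,3,11,5,7,5,0,2,10,5,12,1,3],
  [10,1,5,6,1,11,2,2,8,5,9,12,0,3,8,3,2,8,6,11,7,12,2,12,11,10,11,9,3,9,5,0,2,9,6,6,6,12,6,4,3,1],
  [7,4,4,3,8,8,8,11,3,12,11,8,0,6,4,9,6,3,12,4,9,4,10,0,6,11,7,1,10,1,6,0,8,8,7,1,2,6,6,4,8,12],
  [3,0,8,1,6,11,4,4,10,7,8,12,1,0,1,2,6,11,2,4,5,2,1,7,11,3,10,4,5,9,9,10,5,12,0,1,5,10,4,12,0,10],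
  [0,3,4,0,4,1,1,7,5,6,12,5,8,1,11,12,11,12,10,12,2,6,1,0,0,7,1,8,6,10,1,12,3,2,4,5,2,9,7,3,9,5],
  [0,6,3,7,0,2,9,12,3,5,4,5,7,12,5,8,9,2,9,7,1,4,3,6,11,10,7,5,0,9,11,10,8,5,12,7,7,9,11,12,0,1],
  [0,6,3,12,7,7,0,5,2,4,7,1,2,0,9,4,11,6,11,9,9,7,3,4,7,10,6,5,5,2,0,2,3,11,4,2,4,5,9,4,4,9],
  [0,9,10,7,12,11,9,8,9,8,10,7,2,6,11,1,10,11,9,1,11,4,2,1,7,4,10,12,0,10,1,12,5,7,12,4,1,5,4,3,8,0],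
  [2,12,0,12,8,5,4,4,8,7,5,1,5,8,10,7,5,10,6,11,10,12,12,5,5,1,1,10,6,3,9,11,3,1,12,2,4,12,12,0,12,1],
  [9,2,0,4,10,3,4,5,6,11,3,5,5,3,0,10,0,8,11,9,7,7,2,7,3,5,9,9,8,2,12,3,8,4,8,2,5,11,10,12,11,0],
  [0,10,0,1,2,10,4,3,4,1,9,4,2,6,12,3,7,5,11,12,2,9,6,3,3,7,10,5,10,5,6,10,6,8,10,0,8,7,11,8,6,1],
  [3,5,3,9,5,8,10,5,0,5,4,12,5,5,4,2,5,2,8,7,2,3,7,5,11,6,12,8,4,2,0,8,8,2,8,11,9,11,11,5,3,1],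
  [4,8,9,9,6,11,7,9,9,8,11,5,0,5,5,11,8,11,8,11,11,5,1,0,10,10,10,0,7,11,11,10,3,11,6,10,7,3,4,8,1,0],
  [4,12,11,9,3,7,12,9,2,6,1,3,2,6,9,0,12,4,2,8,0,8,9,6,5,0,4,7,9,10,12,3,7,2,11,7,11,7,12,10,6,0],
  [4,6,1,3,12,5,10,9,4,10,6,7,0,3,10,11,7,4,0,7,0,1,3,2,9,7,12,8,7,0,9,12,4,9,2,4,6,8,5,5,1,6],
  [1,4,8,11,4,5,9,11,11,6,7,10,4,10,8,4,2,12,12,2,0,7,5,3,10,2,12,10,1,12,2,6,2,12,6,10,11,5,11,7,8,8],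
  [8,5,1,10,9,7,12,3,5,12,12,9,10,0,4,12,2,0,9,4,7,9,8,0,6,2,7,3,12,6,0,11,0,8,9,7,3,4,10,10,2,9],
  [2,12,11,2,7,5,2,8,9,10,5,10,0,12,1,8,11,8,5,10,8,0,5,8,6,4,4,12,2,12,8,8,11,1,6,11,5,10,10,3,2,12],
  [11,12,2,7,10,1,4,8,1,2,9,10,4,10,7,9,0,8,8,3,2,10,0,9,4,1,11,12,7,3,1,1,3,2,0,3,3,4,2,4,6,6],
  [5,6,5,4,12,11,4,8,5,7,9,0,5,12,10,0,12,1,7,10,11,4,11,4,5,9,2,11,6,12,8,9,12,0,4,6,2,5,11,0,12,9],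
  [7,1,12,9,12,3,9,3,1,3,0,9,8,5,7,9,0,7,0,11,7,0,4,6,4,5,7,11,4,4,0,1,5,12,11,0,11,11,9,1,9,2],
  [5,6,10,4,4,4,11,2,6,4,3,5,7,1,4,8,10,7,5,10,10,1,5,12,2,0,0,11,8,1,10,3,4,2,10,3,0,9,10,12,4,8],
  [7,3,5,0,3,7,5,10,12,9,5,12,6,8,12,1,2,4,6,5,7,9,10,2,10,5,12,4,2,7,9,8,3,9,1,0,3,12,11,6,8,6],
  [6,2,4,0,9,6,5,4,7,12,5,3,0,3,3,1,8,11,10,5,8,6,3,6,0,1,4,1,12,4,12,11,8,9,4,6,4,1,0,12,1,1],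
  [0,7,9,9,9,5,5,1,10,8,8,7,1,7,11,2,8,11,9,10,10,1,1,4,3,4,8,2,7,9,2,12,11,10,4,8,7,10,9,5,4,0],
  [10,6,7,12,2,8,11,10,8,6,6,9,0,3,6,2,11,6,5,12,2,7,0,7,1,12,2,8,6,7,2,10,3,4,7,0,6,2,3,0,11,8]]

def TL5 : List (List ℕ) := [
  [1,6,3,10,12,5,9,2,9,11,9,0,4,4,9,7,10,1,3,6,6,2,8,3,5,11,2,6,12,11,11,6,7,8,4,1,0,3,2,0,3,12],
  [0,0,0,10,11,0,9,4,1,0,9,0,12,3,0,7,7,3,12,4,0,2,3,9,7,3,12,0,12,9,7,11,9,9,2,0,0,6,6,0,2,7],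
  [1,11,3,1,7,10,12,1,12,6,6,2,1,5,6,7,1,7,11,8,5,9,3,0,1,3,10,2,6,11,0,1,9,2,12,5,3,4,9,1,2,3],
  [0,0,0,10,9,0,9,8,3,0,9,0,10,12,0,7,1,9,9,7,0,2,6,1,2,2,7,0,12,5,8,5,6,2,1,0,0,12,5,0,10,3],
  [0,0,0,1,1,0,12,2,10,0,6,4,3,7,0,7,2,8,5,1,0,9,6,0,4,2,8,0,6,9,0,4,6,12,6,0,3,8,1,4,10,5],
  [1,3,0,5,0,2,12,0,0,2,7,8,11,0,4,9,7,11,6,0,0,1,0,12,10,8,0,7,4,4,6,4,8,9,0,3,3,5,1,8,11,3],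
  [0,0,0,10,5,0,9,3,9,0,9,0,4,9,0,7,2,1,10,9,0,2,12,3,8,10,3,0,12,10,11,7,4,12,7,0,0,11,2,0,11,5],
  [0,0,0,1,2,0,12,4,4,0,6,8,9,2,0,7,4,11,7,5,0,9,12,0,3,10,9,0,6,5,0,3,4,7,3,0,3,3,3,3,11,4],
  [0,0,0,5,0,0,12,0,0,0,7,3,7,0,0,9,1,7,11,0,0,1,0,10,1,1,0,0,4,8,5,3,1,2,0,0,3,10,3,6,3,5],
  [1,8,1,9,0,0,0,12,0,11,1,11,8,0,7,12,7,3,1,0,2,6,4,7,10,0,0,0,1,12,9,2,9,3,0,1,12,7,6,9,9,0],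
  [0,0,0,10,10,0,9,6,1,0,9,0,12,10,0,7,4,3,1,6,0,2,11,9,6,11,5,0,12,7,7,2,7,7,10,0,0,9,6,0,3,4],
  [0,0,0,1,4,0,12,8,12,0,6,3,1,8,0,7,8,7,2,12,0,9,11,0,12,11,2,0,6,10,0,12,7,3,8,0,3,6,9,12,3,11],
  [0,0,0,5,0,0,12,0,0,0,7,6,8,0,0,9,2,8,5,0,0,1,0,4,4,5,0,0,4,3,2,12,5,12,0,0,3,7,9,11,2,4],
  [0,0,0,9,0,0,0,11,0,0,1,9,11,0,0,12,1,9,4,0,0,6,8,8,1,0,0,0,1,11,1,8,6,5,0,0,12,1,5,10,6,0],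
  [1,0,4,0,0,8,4,11,0,4,8,12,5,0,9,4,5,7,9,0,11,9,6,12,0,5,0,8,11,7,2,2,4,10,0,6,8,8,9,9,7,1],
  [0,0,0,10,7,0,9,12,3,0,9,0,10,1,0,7,8,9,4,4,0,2,9,1,11,3,4,0,12,1,8,8,9,3,5,0,0,5,5,0,2,11],
  [0,0,0,1,8,0,12,3,10,0,6,6,3,6,0,7,3,8,8,8,0,9,9,0,9,3,12,0,6,7,0,9,9,5,4,0,3,12,1,9,2,1],
  [0,0,0,5,0,0,12,0,0,0,7,12,11,0,0,9,4,11,7,0,0,1,0,12,3,12,0,0,4,6,6,9,12,7,0,0,3,1,1,5,10,11],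
  [0,0,0,9,0,0,0,9,0,0,1,5,7,0,0,12,2,1,3,0,0,6,3,11,4,0,0,0,1,9,3,6,4,4,0,0,12,2,2,1,4,0],
  [0,0,0,0,0,0,4,9,0,0,8,11,2,0,0,4,10,8,10,0,0,9,12,10,0,12,0,0,11,1,6,8,7,8,0,0,8,3,1,10,9,6],
  [1,5,12,4,0,9,3,10,0,12,0,4,2,0,6,9,6,3,4,0,8,5,10,9,12,10,0,8,5,4,2,7,6,4,0,6,5,0,5,6,0,4],
  [0,12,1,5,1,3,12,6,7,1,3,7,1,0,3,4,4,3,11,11,3,7,8,12,5,7,9,7,9,2,5,0,12,7,11,7,12,6,2,11,5,10],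
  [0,8,3,1,8,5,5,0,9,12,11,12,6,8,0,12,11,4,10,8,5,8,6,6,3,4,5,1,10,9,7,4,0,9,0,3,9,0,7,4,6,3],
  [0,12,2,5,0,9,11,6,0,4,9,1,1,0,2,3,12,6,11,0,5,9,6,10,10,7,0,10,2,10,7,0,11,7,0,4,6,10,10,5,2,7],
  [0,0,0,10,2,0,11,2,4,0,6,7,1,12,0,7,2,10,8,0,0,9,5,6,9,8,9,0,11,2,10,6,12,12,7,0,6,2,11,12,0,1],
  [0,8,6,1,0,2,10,0,0,9,7,11,6,0,0,9,7,8,10,0,4,1,11,5,6,4,0,7,8,6,2,12,0,9,0,11,11,0,9,3,5,6],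
  [0,12,4,5,0,1,9,6,0,3,1,2,1,0,10,12,10,12,11,0,4,6,11,4,7,7,0,5,12,11,2,0,9,7,0,6,3,8,11,7,6,1],
  [0,0,0,6,2,0,4,8,8,0,1,6,4,7,0,2,3,11,8,8,0,10,9,8,11,6,6,0,12,11,10,10,3,2,7,0,3,8,3,6,6,8],
  [0,0,0,10,0,0,9,2,0,0,5,1,1,0,0,2,6,7,8,0,0,6,7,5,5,8,0,0,1,10,1,5,11,12,0,0,3,12,3,9,0,2],
  [0,8,12,1,0,6,7,0,0,10,8,9,6,0,0,10,8,3,10,0,11,5,5,2,12,4,0,10,9,4,8,10,0,9,0,10,12,0,6,12,2,12],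
  [0,12,8,5,0,3,5,6,0,12,3,4,1,0,11,9,4,11,11,0,11,4,5,12,1,7,0,9,7,3,8,0,5,7,0,9,8,9,3,2,5,2],
  [0,0,0,2,0,0,10,11,12,0,9,9,2,7,0,10,4,2,1,2,0,11,3,7,9,3,8,0,0,10,9,10,3,8,2,0,0,11,10,12,8,8],
  [0,0,0,6,0,0,8,8,0,0,3,12,4,0,0,8,9,9,8,0,0,11,10,11,9,6,0,0,7,3,1,4,6,2,0,0,8,9,2,11,5,3],
  [0,0,0,10,0,0,5,2,0,0,2,2,1,0,0,8,5,1,8,0,0,4,2,2,10,8,0,0,6,11,4,2,9,12,0,0,8,7,2,10,0,4],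
  [0,8,11,1,0,5,1,0,0,1,11,5,6,0,0,1,11,6,10,0,1,12,7,6,11,4,0,5,2,7,6,4,0,9,0,2,6,0,4,9,6,11],
  [0,12,3,5,0,9,10,6,0,9,9,8,1,0,3,10,12,9,11,0,1,7,7,10,2,7,0,11,3,2,6,0,10,7,0,7,4,2,2,8,2,4],
  [0,0,0,11,5,0,3,12,0,0,4,12,2,9,0,5,4,4,10,2,0,12,2,9,0,10,10,0,1,9,3,11,7,11,10,0,10,12,7,0,8,3],
  [0,0,0,2,0,0,7,11,0,0,1,5,2,0,0,1,12,4,1,0,0,3,12,8,5,3,0,0,0,11,10,4,6,8,0,0,0,1,11,9,11,3],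
  [0,0,0,6,0,0,3,8,0,0,9,11,4,0,0,6,1,5,8,0,0,3,1,7,5,6,0,0,3,2,4,12,12,2,0,0,4,2,10,5,2,6],
  [0,0,0,10,0,0,10,2,0,0,6,4,1,0,0,6,2,2,8,0,0,7,8,6,7,8,0,0,10,3,3,6,5,12,0,0,4,3,10,1,0,8],
  [0,8,9,1,0,2,2,0,0,4,7,10,6,0,0,4,7,12,10,0,6,8,2,5,9,4,0,9,12,9,11,12,0,9,0,3,3,0,7,10,5,9],
  [0,12,6,5,0,1,7,6,0,10,1,3,1,0,2,1,10,5,11,0,6,9,2,4,4,7,0,12,5,10,11,0,7,7,0,4,2,12,10,6,6,8]]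

def mons4 : List (ℕ × ℕ) := [(0, 0), (1, 0), (0, 1), (2, 0), (1, 1), (0, 2), (3, 0), (2, 1), (1, 2), (0, 3), (4, 0), (3, 1), (2, 2), (1, 3), (0, 4)]

def pts4 : List (ℕ × ℕ) := [(0, 1), (0, 2), (1, 1), (2, 0), (0, 3), (1, 2), (2, 1), (3, 0), (0, 4), (1, 3), (2, 2), (3, 1), (4, 0), (0, 5), (1, 4), (2, 3), (3, 2), (4, 1), (5, 0), (0, 6), (1, 5), (2, 4), (3, 3), (4, 2), (5, 1), (6, 0), (0, 7), (1, 6), (2, 5), (3, 4)]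

def NL4 : List (List ℕ) := [
  [2,3,1,0,10,7,10,0,8,8,5,6,7,7,4,3,6,8,2,3,9,2,1,12,4,6,7,0,11,10],
  [1,6,4,3,9,3,7,11,2,7,6,12,1,2,2,9,3,11,6,4,3,12,3,6,1,2,0,8,0,4],
  [3,1,5,0,5,4,9,11,10,12,6,6,5,4,10,5,11,8,5,3,11,1,4,5,9,10,7,6,2,3],
  [0,1,9,1,2,7,10,12,3,6,5,3,3,8,5,6,0,7,9,6,11,12,8,11,3,11,7,3,4,8],
  [8,0,4,5,1,3,1,11,9,6,2,3,8,0,5,9,6,10,8,11,8,1,9,0,8,3,1,11,11,0],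
  [9,6,7,6,2,10,1,6,3,11,2,9,11,11,12,2,9,11,4,7,2,8,8,12,1,0,10,3,7,10],
  [1,10,4,10,12,2,8,0,7,11,0,9,11,3,9,3,11,11,6,9,10,3,1,4,2,10,3,4,11,2],
  [3,2,2,10,3,11,8,8,12,5,0,8,10,1,2,8,1,12,7,0,11,9,4,4,5,1,2,5,11,8],
  [5,8,2,5,12,7,1,10,1,2,12,2,10,8,12,2,2,8,2,4,11,1,6,12,3,7,9,10,0,9],
  [5,12,7,4,1,9,6,1,5,12,1,0,5,12,11,6,2,4,3,6,2,7,8,12,1,9,11,10,1,0],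
  [10,1,3,0,6,10,10,5,6,3,11,4,0,8,11,8,5,2,11,12,3,1,8,1,9,11,7,5,8,7],
  [7,12,2,9,12,10,1,1,4,0,9,12,8,0,7,7,12,11,8,1,8,10,1,10,3,0,5,4,2,8],
  [7,7,9,8,3,9,10,11,1,7,2,0,0,7,1,12,4,1,6,1,6,10,0,0,5,9,2,3,4,10],
  [1,10,7,7,0,5,5,9,3,8,6,11,4,11,2,11,8,5,4,12,4,11,3,12,4,6,8,10,2,11],
  [1,12,10,2,12,9,10,3,9,12,1,4,8,0,10,7,10,1,11,10,8,6,10,8,1,2,1,11,10,12],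
  [0,12,0,1,5,5,6,1,2,12,10,5,10,1,10,5,8,3,7,4,11,8,7,10,9,7,4,10,10,6],
  [11,11,12,0,4,7,6,1,3,4,6,8,4,10,3,1,0,6,9,10,11,7,2,6,11,9,3,8,6,4],
  [11,7,11,9,9,5,8,9,12,1,2,7,11,12,4,0,8,11,7,7,3,3,9,1,8,12,2,12,3,8],
  [10,8,6,11,4,7,4,9,7,4,9,11,2,10,1,4,0,2,6,5,10,4,2,3,8,10,10,9,6,1],
  [9,3,2,0,2,4,6,6,12,1,5,3,4,4,12,6,11,0,6,10,12,4,3,12,11,9,4,9,7,3],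
  [5,12,11,2,1,5,6,12,8,1,4,5,5,6,1,0,1,3,0,6,11,1,9,5,6,8,10,12,10,0],
  [12,1,2,4,6,0,9,1,12,8,9,0,2,3,4,5,7,6,3,10,8,7,10,3,8,10,7,10,0,3],
  [7,12,10,6,11,5,10,12,4,2,0,5,0,0,11,10,12,2,11,8,3,11,9,9,6,1,6,6,0,1],
  [4,0,6,12,4,3,12,4,4,0,8,3,10,5,9,5,4,9,9,6,11,7,8,5,6,9,4,11,11,1],
  [10,2,1,0,8,9,8,8,5,2,0,4,12,5,4,5,7,6,7,3,12,11,4,10,3,4,2,10,8,6],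
  [3,12,1,8,1,2,12,4,7,8,6,8,12,3,11,10,6,8,8,3,0,9,6,11,1,5,8,6,3,6],
  [12,10,8,5,2,2,5,2,9,3,8,8,7,1,6,1,9,7,8,10,1,2,11,4,11,12,7,9,3,8],
  [2,3,1,2,10,11,10,5,8,10,1,3,2,4,11,9,9,1,0,7,6,4,7,5,1,0,2,12,8,8],
  [5,6,3,8,11,2,11,7,1,4,8,7,1,5,12,4,5,3,7,6,11,9,8,1,11,3,9,11,12,9],
  [9,9,5,2,1,12,2,8,10,6,1,9,1,5,0,11,1,12,1,9,8,6,2,4,9,0,7,2,7,7]]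

def TL4 : List (List ℕ) := [
  [4,2,11,8,12,6,10,6,3,6,0,7,7,6,9,11,5,2,4,4,10,1,2,12,3,10,4,8,3,3],
  [0,0,11,3,0,6,7,5,0,6,0,8,2,0,9,9,2,8,7,0,10,2,6,9,2,8,0,8,6,9],
  [8,12,9,3,6,2,4,7,5,9,12,2,4,4,1,2,1,11,9,7,5,12,4,9,7,8,9,3,11,8],
  [0,0,11,6,0,6,1,2,0,6,0,11,8,0,9,5,6,6,9,0,10,4,5,10,10,9,0,8,12,1],
  [0,0,9,6,0,2,8,8,0,9,11,6,3,0,1,4,3,5,6,0,5,11,12,10,9,9,0,3,9,11],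
  [12,1,7,0,6,10,11,0,5,0,9,10,0,7,7,4,10,7,0,5,8,2,6,1,11,0,8,8,9,3],
  [0,0,11,12,0,6,2,6,0,6,0,7,6,0,9,10,5,11,6,0,10,8,2,1,11,2,0,8,11,3],
  [0,0,9,12,0,2,3,11,0,9,9,5,12,0,1,8,9,7,4,0,5,9,10,1,6,2,0,3,5,7],
  [0,0,7,0,0,10,9,0,0,0,5,4,0,0,7,8,4,2,0,0,8,4,5,4,3,0,0,8,5,9],
  [3,8,5,0,8,6,5,0,12,10,1,5,0,9,1,6,10,3,0,3,7,6,0,7,2,0,9,1,10,0],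
  [0,0,11,11,0,6,4,5,0,6,0,8,11,0,9,7,2,5,4,0,10,3,6,4,3,12,0,8,9,9],
  [0,0,9,11,0,2,6,7,0,9,5,2,9,0,1,3,1,2,7,0,5,5,4,4,4,12,0,3,10,8],
  [0,0,7,0,0,10,5,0,0,0,10,12,0,0,7,3,12,8,0,0,8,8,2,3,2,0,0,8,10,1],
  [0,0,5,0,0,6,10,0,0,10,2,2,0,0,1,12,4,12,0,0,7,12,0,2,10,0,0,1,7,0],
  [7,2,3,0,7,10,12,0,3,8,7,0,0,6,0,0,0,12,0,12,0,3,11,11,6,0,7,10,5,4],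
  [8,5,12,5,2,8,4,9,5,2,9,5,0,2,7,7,2,3,3,2,9,1,8,12,9,6,9,6,10,12],
  [9,5,1,7,4,5,1,7,7,11,6,7,9,0,3,6,2,3,6,4,2,7,0,11,2,2,6,12,11,1],
  [8,10,12,0,6,3,4,0,7,6,5,5,0,10,2,8,4,3,0,12,6,4,11,11,9,0,11,10,11,9],
  [0,0,3,8,0,2,1,0,0,7,1,10,7,0,12,9,7,2,11,0,8,11,6,0,3,3,0,5,4,2],
  [9,10,1,0,12,10,1,0,2,7,12,7,0,0,12,5,4,3,0,11,10,2,0,9,2,0,3,7,3,4],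
  [8,7,12,0,5,6,4,0,2,5,10,5,0,11,8,11,8,3,0,7,4,3,7,9,9,0,12,8,3,10],
  [0,0,5,4,0,12,0,2,0,3,6,10,3,0,8,12,11,7,12,0,1,3,10,6,6,3,0,11,11,3],
  [0,0,3,0,0,4,1,0,0,8,2,10,0,0,9,1,1,2,0,0,1,5,5,0,3,0,0,4,7,8],
  [9,7,1,0,10,7,1,0,8,8,11,7,0,0,9,2,8,3,0,1,11,8,0,5,2,0,8,3,2,3],
  [8,1,12,0,2,12,4,0,8,2,7,5,0,3,6,7,3,3,0,3,7,12,8,5,9,0,6,9,2,1],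
  [0,0,7,10,0,9,9,12,0,12,7,9,3,0,4,12,3,11,1,0,7,7,6,9,11,6,0,4,2,0],
  [0,0,5,0,0,11,0,0,0,9,12,10,0,0,6,10,9,7,0,0,5,12,4,12,6,0,0,1,3,12],
  [0,0,3,0,0,8,1,0,0,11,4,10,0,0,10,3,2,2,0,0,5,7,2,0,3,0,0,11,9,6],
  [9,1,1,0,4,1,1,0,6,11,9,7,0,0,10,6,3,3,0,6,3,6,0,10,2,0,4,5,10,12],
  [8,2,12,0,6,11,4,0,6,6,1,5,0,2,11,8,6,3,0,5,9,9,11,10,9,0,3,2,10,4]]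
def mon5 (i : Fin 21) : ℕ × ℕ := mons5.getD i (0, 0)
def mon4 (i : Fin 15) : ℕ × ℕ := mons4.getD i (0, 0)

def M5 (j k : Fin (21 + 21)) : ℤ :=
  if j = 0 then Fin.addCases (fun i => 0 ^ (mon5 i).1 * 1 ^ (mon5 i).2) (fun _ => 0) k
  else Fin.addCases
    (fun i => entA 1 1 (pts5.getD j (0, 0)).1 (pts5.getD j (0, 0)).2 (mon5 i))
    (fun i => entB 1 1 (pts5.getD j (0, 0)).1 (pts5.getD j (0, 0)).2 (mon5 i)) k

def M4 (j k : Fin (15 + 15)) : ℤ :=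
  Fin.addCases
    (fun i => entA 5 6 (pts4.getD j (0, 0)).1 (pts4.getD j (0, 0)).2 (mon4 i))
    (fun i => entB 5 6 (pts4.getD j (0, 0)).1 (pts4.getD j (0, 0)).2 (mon4 i)) k

lemma mon5_inj : Function.Injective mon5 := by unfold Function.Injective; decide +kernel
lemma mon4_inj : Function.Injective mon4 := by unfold Function.Injective; decide +kernel
lemma mon5_surj : ∀ k < 5 + 1, ∀ l < 5 + 1, k + l ≤ 5 → ∃ i, mon5 i = (k, l) := by decide +kernel
lemma mon4_surj : ∀ k < 4 + 1, ∀ l < 4 + 1, k + l ≤ 4 → ∃ i, mon4 i = (k, l) := by decide +kernel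

lemma len5 : ∀ i : Fin (21 + 21), (NL5.getD i []).length ≤ 21 + 21 := by decide +kernel
lemma len4 : ∀ i : Fin (15 + 15), (NL4.getD i []).length ≤ 15 + 15 := by decide +kernel
lemma inv5 : ∀ i k : Fin (21 + 21),
    dot (NL5.getD i []) (TL5.getD k []) % 13 = if i = k then 1 else 0 := by decide +kernel
lemma inv4 : ∀ i k : Fin (15 + 15),
    dot (NL4.getD i []) (TL4.getD k []) % 13 = if i = k then 1 else 0 := by decide +kernel
lemma tab5 : ∀ j k : Fin (21 + 21), (M5 j k - ((TL5.getD k []).getD j 0 : ℕ)) % 13 = 0 := by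
  decide +kernel
lemma tab4 : ∀ j k : Fin (15 + 15), (M4 j k - ((TL4.getD k []).getD j 0 : ℕ)) % 13 = 0 := by
  decide +kernel

lemma sol4 {A B : MvPolynomial (Fin 2) ℂ} (hA : A.totalDegree ≤ 4) (hB : B.totalDegree ≤ 4)
    (h : C ((5 : ℤ) : ℂ) * (pderiv 0 g * B - pderiv 1 g * A)
      = C ((6 : ℤ) : ℂ) * (g * (pderiv 0 B - pderiv 1 A))) : A = 0 ∧ B = 0 := by
  have key := kernel_zero (15 + 15) M4 NL4 TL4 len4 inv4 tab4
    (Fin.append (fun i => coeff (toF (mon4 i)) A) (fun i => coeff (toF (mon4 i)) B)) (by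
      intro j
      rw [Fin.sum_univ_add]
      simp only [Fin.append_left, Fin.append_right, M4, Fin.addCases_left, Fin.addCases_right]
      exact row_eq hA hB mon4 mon4_inj mon4_surj 5 6 h _ _)
  constructor
  · rw [expand hA mon4 mon4_inj mon4_surj]
    refine Finset.sum_eq_zero fun i _ => ?_
    have := congrFun key (Fin.castAdd 15 i)
    rw [Fin.append_left] at this
    rw [this]; simp
  · rw [expand hB mon4 mon4_inj mon4_surj]
    refine Finset.sum_eq_zero fun i _ => ?_
    have := congrFun key (Fin.natAdd 15 i)
    rw [Fin.append_right] at this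
    rw [this]; simp

lemma sol5 {A B : MvPolynomial (Fin 2) ℂ} (hA : A.totalDegree ≤ 5) (hB : B.totalDegree ≤ 5)
    (h0 : ev 0 1 A = 0)
    (h : C ((1 : ℤ) : ℂ) * (pderiv 0 g * B - pderiv 1 g * A)
      = C ((1 : ℤ) : ℂ) * (g * (pderiv 0 B - pderiv 1 A))) : A = 0 ∧ B = 0 := by
  have key := kernel_zero (21 + 21) M5 NL5 TL5 len5 inv5 tab5
    (Fin.append (fun i => coeff (toF (mon5 i)) A) (fun i => coeff (toF (mon5 i)) B)) (by
      intro j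
      rw [Fin.sum_univ_add]
      by_cases hj : j = 0
      · simp only [Fin.append_left, Fin.append_right, M5, if_pos hj, Fin.addCases_left,
          Fin.addCases_right]
        rw [expand hA mon5 mon5_inj mon5_surj, map_sum] at h0
        simp only [ev_monomial, toF_zero, toF_one] at h0
        simp only [Int.cast_zero, zero_mul, Finset.sum_const_zero, add_zero]
        rw [← h0]
        refine Finset.sum_congr rfl fun i _ => ?_
        push_cast
        ring
      · simp only [Fin.append_left, Fin.append_right, M5, if_neg hj, Fin.addCases_left,
          Fin.addCases_right]
        exact row_eq hA hB mon5 mon5_inj mon5_surj 1 1 h _ _)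
  constructor
  · rw [expand hA mon5 mon5_inj mon5_surj]
    refine Finset.sum_eq_zero fun i _ => ?_
    have := congrFun key (Fin.castAdd 21 i)
    rw [Fin.append_left] at this
    rw [this]; simp
  · rw [expand hB mon5 mon5_inj mon5_surj]
    refine Finset.sum_eq_zero fun i _ => ?_
    have := congrFun key (Fin.natAdd 21 i)
    rw [Fin.append_right] at this
    rw [this]; simp

/-! ### A smooth point -/

lemma smooth_pt : ∃ s t : ℂ, ev s t g = 0 ∧ ev s t (pderiv 0 g) ≠ 0 := by
  obtain ⟨w, hw⟩ := IsAlgClosed.exists_pow_nat_eq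
    ((984082161242880 : ℂ) ^ 2 - 4 * 453566387668320 * 550265798525184) (n := 2) (by norm_num)
  obtain ⟨r, hr⟩ : ∃ r : ℂ, 2 * 453566387668320 * r - 984082161242880 = w :=
    ⟨(w + 984082161242880) / (2 * 453566387668320), by field_simp; ring⟩
  have hq : 453566387668320 * r ^ 2 - 984082161242880 * r + 550265798525184 = 0 := by
    have : (4 * 453566387668320 : ℂ) * (453566387668320 * r ^ 2 - 984082161242880 * r
      + 550265798525184) = 0 := by
      rw [← hr] at hw
      linear_combination hw
    exact (mul_eq_zero.mp this).resolve_left (by norm_num)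
  have hw0 : w ≠ 0 := by
    rintro rfl
    norm_num at hw
  have hr0 : r ≠ 0 := by
    rintro rfl
    norm_num at hq
  have hr1 : r - 1 ≠ 0 := by
    intro h
    have : r = 1 := sub_eq_zero.mp h
    subst this
    norm_num at hq
  refine ⟨r, 0, ?_, ?_⟩
  · have h := ev_g r 0
    have h2 : E0 r (0 : ℂ) = 0 := by
      have : E0 r (0 : ℂ) = -(r ^ 2 * (r - 1) ^ 2) *
        (453566387668320 * r ^ 2 - 984082161242880 * r + 550265798525184) := by
        simp only [E0, fI, gI, hI]; ring
      rw [this, hq, mul_zero]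
    rw [h2] at h
    exact (mul_eq_zero.mp h).resolve_left (by norm_num)
  · intro h0
    have h := ev_gx r 0
    rw [h0, mul_zero] at h
    have : Ex r (0 : ℂ) = -(r ^ 2 * (r - 1) ^ 2 * w) := by
      have : Ex r (0 : ℂ) = -(r ^ 2 * (r - 1) ^ 2) *
        (2 * 453566387668320 * r - 984082161242880) - (2 * r * (r - 1) * (2 * r - 1)) *
        (453566387668320 * r ^ 2 - 984082161242880 * r + 550265798525184) := by
        simp only [Ex, fI, gI, hI, fx, gx, hx]; ring
      rw [this, hq, hr]; ring
    rw [this] at h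
    have := mul_ne_zero (mul_ne_zero (pow_ne_zero 2 hr0) (pow_ne_zero 2 hr1)) hw0
    exact this (neg_eq_zero.mp h.symm)

/-! ### Degrees -/

lemma td_pderiv {p : MvPolynomial (Fin 2) ℂ} (i : Fin 2) (h : pderiv i p ≠ 0) :
    (pderiv i p).totalDegree + 1 ≤ p.totalDegree := by
  have key : ∀ m ∈ (pderiv i p).support, (m.sum fun _ e => e) + 1 ≤ p.totalDegree := by
    intro m hm
    rw [mem_support_iff, coeff_pderiv] at hm
    have hm' : m + Finsupp.single i 1 ∈ p.support := by
      rw [mem_support_iff]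
      intro h0
      rw [h0] at hm
      simp at hm
    have := le_totalDegree hm'
    rw [Finsupp.sum_add_index' (fun _ => rfl) (fun _ _ _ => rfl)] at this
    simpa using this
  obtain ⟨m, hm⟩ := support_nonempty.mpr h
  have h1 := key m hm
  have : (pderiv i p).totalDegree ≤ p.totalDegree - 1 := by
    refine Finset.sup_le fun m hm => ?_
    have := key m hm
    omega
  omega

lemma td_mul_pderiv {p q : MvPolynomial (Fin 2) ℂ} (i : Fin 2) {a b d : ℕ}
    (hp : p.totalDegree ≤ a) (hq : q.totalDegree ≤ b) (h : a + b ≤ d + 1) :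
    (p * pderiv i q).totalDegree ≤ d := by
  by_cases h0 : pderiv i q = 0
  · simp [h0]
  · have h1 := td_pderiv i h0
    have h2 := totalDegree_mul p (pderiv i q)
    omega

lemma td_add {p q : MvPolynomial (Fin 2) ℂ} {d : ℕ} (hp : p.totalDegree ≤ d)
    (hq : q.totalDegree ≤ d) : (p + q).totalDegree ≤ d :=
  (totalDegree_add p q).trans (max_le hp hq)
lemma td_sub {p q : MvPolynomial (Fin 2) ℂ} {d : ℕ} (hp : p.totalDegree ≤ d)
    (hq : q.totalDegree ≤ d) : (p - q).totalDegree ≤ d :=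
  (totalDegree_sub p q).trans (max_le hp hq)
lemma td_Cmul {p : MvPolynomial (Fin 2) ℂ} {d : ℕ} (a : ℂ) (hp : p.totalDegree ≤ d) :
    (C a * p).totalDegree ≤ d := by
  have := totalDegree_mul (C a) p
  rw [totalDegree_C] at this
  omega
lemma td_mul {p q : MvPolynomial (Fin 2) ℂ} {d e : ℕ} (hp : p.totalDegree ≤ d)
    (hq : q.totalDegree ≤ e) : (p * q).totalDegree ≤ d + e :=
  (totalDegree_mul p q).trans (Nat.add_le_add hp hq)

/-- The generic conic has degree at most two. -/
lemma td_conic (a0 a1 a2 a3 a4 a5 : ℂ) :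
    (C a0 + C a1 * (x * y) + C a2 * (y * y) + C a3 * y + C a4 * x + C a5 * (x * x)).totalDegree
      ≤ 2 := by
  have hx : x.totalDegree ≤ 1 := by simp [x]
  have hy : y.totalDegree ≤ 1 := by simp [y]
  refine td_add (td_add (td_add (td_add (td_add ?_ ?_) ?_) ?_) ?_) ?_
  · simp
  · exact td_Cmul _ (td_mul hx hy)
  · exact td_Cmul _ (td_mul hy hy)
  · exact td_Cmul _ (hy.trans (by norm_num))
  · exact td_Cmul _ (hx.trans (by norm_num))
  · exact td_Cmul _ (td_mul hx hx)

lemma td_f2 : f2.totalDegree ≤ 2 := by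
  have := td_conic 1 (-((1/3 : ℚ) : ℂ)) ((8203/31752 : ℚ) : ℂ) ((1/3 : ℚ) : ℂ)
    (-((5444/3969 : ℚ) : ℂ)) ((1475/3969 : ℚ) : ℂ)
  convert this using 2
  simp only [f2, c, C_1, C_neg]; ring
lemma td_g2 : g2.totalDegree ≤ 2 := by
  have := td_conic 1 (-1) ((21139/31752 : ℚ) : ℂ) 1
    (-((14857/7938 : ℚ) : ℂ)) ((6919/7938 : ℚ) : ℂ)
  convert this using 2
  simp only [g2, c, C_1, C_neg]; ring
lemma td_h2 : h2.totalDegree ≤ 2 := by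
  have := td_conic (-1) 1 (-((24667/31752 : ℚ) : ℂ)) 1
    ((1475/3969 : ℚ) : ℂ) (-((36115/47628 : ℚ) : ℂ))
  convert this using 2
  simp only [h2, c, C_1, C_neg]; ring

lemma td_g : g.totalDegree ≤ 6 := by
  have h : g = f2 * f2 * f2 + g2 * g2 * h2 := by rw [g]; ring
  rw [h]
  exact td_add (td_mul (td_mul td_f2 td_f2) td_f2) (td_mul (td_mul td_g2 td_g2) td_h2)

lemma pd_comm (p : MvPolynomial (Fin 2) ℂ) :
    pderiv 0 (pderiv 1 p) = pderiv 1 (pderiv 0 p) := by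
  ext m
  simp only [coeff_pderiv]
  rw [add_right_comm]
  simp
  ring

lemma isUnit_of_pd {p : MvPolynomial (Fin 2) ℂ} (hp : p ≠ 0) (h0 : pderiv 0 p = 0)
    (h1 : pderiv 1 p = 0) : IsUnit p := by
  have hi : ∀ i, pderiv i p = 0 := by
    intro i
    fin_cases i
    · exact h0
    · exact h1
  have key : p = C (coeff 0 p) := by
    ext m
    rw [coeff_C]
    split_ifs with hm
    · rw [hm]
    · obtain ⟨i, hmi⟩ : ∃ i, m i ≠ 0 := by
        by_contra hcon
        push Not at hcon
        exact hm (Finsupp.ext fun i => (hcon i).symm)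
      have h := coeff_pderiv (i := i) p (m - Finsupp.single i 1)
      rw [hi i, coeff_zero, tsub_add_cancel_of_le (by
        rw [Finsupp.single_le_iff]; omega)] at h
      have h2 : (((m - Finsupp.single i 1 : Fin 2 →₀ ℕ) i : ℕ) : ℂ) + 1 ≠ 0 :=
        Nat.cast_add_one_ne_zero _
      rcases mul_eq_zero.mp h.symm with h3 | h3
      · exact h3
      · exact absurd h3 h2
  rw [key]
  refine (IsUnit.mk0 _ ?_).map C
  intro h
  rw [h, C_0] at key
  exact hp key

lemma g_irr : Irreducible g := by
  obtain ⟨s, t, hP, hPx⟩ := smooth_pt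
  have hg0 : g ≠ 0 := by
    intro h
    rw [h] at hPx
    simp at hPx
  refine ⟨?_, ?_⟩
  · intro h
    have := h.map (ev s t)
    rw [hP] at this
    exact not_isUnit_zero this
  · intro a b hab
    have ha0 : a ≠ 0 := by rintro rfl; exact hg0 (by rw [hab, zero_mul])
    have hb0 : b ≠ 0 := by rintro rfl; exact hg0 (by rw [hab, mul_zero])
    have hd : b.totalDegree + a.totalDegree ≤ 5 + 1 := by
      have := td_g
      rw [hab, totalDegree_mul_of_isDomain ha0 hb0] at this
      omega
    have hgx : pderiv 0 g = a * pderiv 0 b + b * pderiv 0 a := by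
      rw [hab, pderiv_mul]; ring
    have hgy : pderiv 1 g = a * pderiv 1 b + b * pderiv 1 a := by
      rw [hab, pderiv_mul]; ring
    have hne : ev 0 1 (pderiv 0 g) ≠ 0 := by
      intro h
      have h2 := ev_gx 0 1
      rw [h] at h2
      norm_num [Ex, fI, gI, hI, fx, gx, hx] at h2
    have hcomm : pderiv 0 (pderiv 1 a) = pderiv 1 (pderiv 0 a) := pd_comm a
    have hcommg : pderiv 0 (pderiv 1 g) = pderiv 1 (pderiv 0 g) := pd_comm g
    obtain ⟨l, hl⟩ : ∃ l : ℂ, ev 0 1 (b * pderiv 0 a) = l * ev 0 1 (pderiv 0 g) :=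
      ⟨_, (div_mul_cancel₀ _ hne).symm⟩
    obtain ⟨hA, hB⟩ := sol5 (A := b * pderiv 0 a - C l * pderiv 0 g)
      (B := b * pderiv 1 a - C l * pderiv 1 g)
      (td_sub (td_mul_pderiv 0 le_rfl le_rfl hd)
        (td_Cmul _ (by simpa using td_mul_pderiv (p := 1) 0 (a := 0) (d := 5) (by simp) td_g le_rfl)))
      (td_sub (td_mul_pderiv 1 le_rfl le_rfl hd)
        (td_Cmul _ (by simpa using td_mul_pderiv (p := 1) 1 (a := 0) (d := 5) (by simp) td_g le_rfl)))
      (by rw [map_sub, hl, map_mul, ev_C, sub_self])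
      (by
        simp only [map_sub, pderiv_mul, pderiv_C, zero_mul, zero_add, hcomm, hcommg]
        rw [hgx, hgy, hab]
        ring)
    rw [sub_eq_zero] at hA hB
    have hAP := congrArg (ev s t) hA
    have hgP := congrArg (ev s t) hgx
    have hPab := hP
    rw [hab] at hPab
    simp only [map_mul, map_add, ev_C] at hAP hgP hPab
    rcases mul_eq_zero.mp hPab with h | h
    · right
      rw [h, zero_mul, zero_add] at hgP
      rw [← hgP] at hAP
      have hl1 : l = 1 := by
        have : (l - 1) * ev s t (pderiv 0 g) = 0 := by linear_combination -hAP
        exact sub_eq_zero.mp ((mul_eq_zero.mp this).resolve_right hPx)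
      subst hl1
      rw [C_1, one_mul] at hA hB
      refine isUnit_of_pd hb0 ?_ ?_
      · have : a * pderiv 0 b = 0 := by linear_combination -hA - hgx
        exact (mul_eq_zero.mp this).resolve_left ha0
      · have : a * pderiv 1 b = 0 := by linear_combination -hB - hgy
        exact (mul_eq_zero.mp this).resolve_left ha0
    · left
      rw [h, zero_mul] at hAP
      have hl0 : l = 0 := (mul_eq_zero.mp hAP.symm).resolve_right hPx
      subst hl0
      rw [C_0, zero_mul] at hA hB
      exact isUnit_of_pd ha0 ((mul_eq_zero.mp hA).resolve_left hb0)
        ((mul_eq_zero.mp hB).resolve_left hb0)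

lemma g_non_torus : ¬ ∃ p q : MvPolynomial (Fin 2) ℂ,
    p.totalDegree ≤ 2 ∧ q.totalDegree ≤ 3 ∧ g = p ^ 3 + q ^ 2 := by
  rintro ⟨p, q, hp, hq, hpq⟩
  obtain ⟨s, t, hP, hPx⟩ := smooth_pt
  have hcp : pderiv 0 (pderiv 1 p) = pderiv 1 (pderiv 0 p) := pd_comm p
  have hcq : pderiv 0 (pderiv 1 q) = pderiv 1 (pderiv 0 q) := pd_comm q
  have hgx : pderiv 0 g = 3 * p ^ 2 * pderiv 0 p + 2 * q * pderiv 0 q := by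
    rw [hpq, map_add, pderiv_pow, pderiv_pow]; push_cast; ring
  have hgy : pderiv 1 g = 3 * p ^ 2 * pderiv 1 p + 2 * q * pderiv 1 q := by
    rw [hpq, map_add, pderiv_pow, pderiv_pow]; push_cast; ring
  have h5 : (C ((5 : ℤ) : ℂ) : MvPolynomial (Fin 2) ℂ) = 5 := by
    rw [Int.cast_ofNat]; exact map_ofNat C 5
  have h6 : (C ((6 : ℤ) : ℂ) : MvPolynomial (Fin 2) ℂ) = 6 := by
    rw [Int.cast_ofNat]; exact map_ofNat C 6
  have h2 : (C (2 : ℂ) : MvPolynomial (Fin 2) ℂ) = 2 := map_ofNat C 2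
  have h3 : (C (3 : ℂ) : MvPolynomial (Fin 2) ℂ) = 3 := map_ofNat C 3
  obtain ⟨hA, -⟩ := sol4 (A := C 2 * (p * pderiv 0 q) - C 3 * (q * pderiv 0 p))
    (B := C 2 * (p * pderiv 1 q) - C 3 * (q * pderiv 1 p))
    (td_sub (td_Cmul _ (td_mul_pderiv 0 hp hq le_rfl)) (td_Cmul _ (td_mul_pderiv 0 hq hp le_rfl)))
    (td_sub (td_Cmul _ (td_mul_pderiv 1 hp hq le_rfl)) (td_Cmul _ (td_mul_pderiv 1 hq hp le_rfl)))
    (by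
      simp only [map_sub, pderiv_mul, pderiv_C, zero_mul, zero_add, hcp, hcq]
      rw [hgx, hgy, hpq, h5, h6, h2, h3]
      ring)
  have hA' := congrArg (ev s t) hA
  have hgP := congrArg (ev s t) hgx
  have hPab := hP
  rw [hpq] at hPab
  simp only [map_sub, map_mul, map_add, map_pow, map_zero, map_ofNat] at hA' hgP hPab
  by_cases hp0 : ev s t p = 0
  · have hq0 : ev s t q = 0 := by
      rw [hp0] at hPab
      simpa using hPab
    rw [hp0, hq0] at hgP
    apply hPx
    rw [hgP]; ring
  · have : ev s t p * ev s t (pderiv 0 g) = 0 := by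
      rw [hgP]
      linear_combination 3 * ev s t (pderiv 0 p) * hPab + ev s t q * hA'
    exact hPx ((mul_eq_zero.mp this).resolve_left hp0)

/-- `g` is irreducible and of non-torus type. -/
theorem g_irreducible_and_non_torus :
    Irreducible g ∧
      ¬ ∃ p q : MvPolynomial (Fin 2) ℂ,
        p.totalDegree ≤ 2 ∧ q.totalDegree ≤ 3 ∧ g = p ^ 3 + q ^ 2 := by
  exact ⟨g_irr, g_non_torus⟩

end
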